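/- The dual Grothendieck polynomial g_lambda in m variables, defined by g_lambda = sum_mu f_lambda^mu s_mu where f_lambda^mu counts semistandard tableaux of skew shape lambda/mu whose i-th row entries lie in [1, i-1], has all coefficients f_lambda^mu nonnegative, and f_lambda^mu is nonzero if and only if (lambda_1, 0, ..., 0) ≤ mu ≤ lambda componentwise. Consequently g_lambda has saturated Newton polytope and Newton(g_lambda) has the integer decomposition property. -/

import Mathlib

open Finset Pointwise

/-- The Young diagram of a partition with at most `m` parts given as an antitone map. -/
def diagramOf {m : ℕ} (lam : Fin m → ℕ) (h : Antitone lam) : YoungDiagram where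
  cells := Finset.univ.biUnion fun i : Fin m =>
    (Finset.range (lam i)).image fun j => ((i : ℕ), j)
  isLowerSet := by
    rintro ⟨i₁, j₁⟩ ⟨i₂, j₂⟩ ⟨hi, hj⟩ hm
    simp only [Finset.coe_biUnion, Finset.coe_univ, Set.mem_iUnion, Finset.mem_coe,
      Finset.mem_image, Finset.mem_range, Set.mem_univ, true_and, Set.iUnion_true] at hm ⊢
    obtain ⟨i, j, hj', hij⟩ := hm
    have hi1 : (i₁ : ℕ) = (i : ℕ) := ((Prod.mk.injEq _ _ _ _).mp hij).1.symm
    have hj1 : j₁ = j := ((Prod.mk.injEq _ _ _ _).mp hij).2.symm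
    have hi2m : i₂ < m := lt_of_le_of_lt (le_of_le_of_eq hi hi1) i.isLt
    refine ⟨⟨i₂, hi2m⟩, j₂, ?_, rfl⟩
    have : lam i ≤ lam ⟨i₂, hi2m⟩ := h (by simpa [Fin.le_def] using le_of_le_of_eq hi hi1)
    omega

/-- The content of a tableau: the number of cells with entry `e`. -/
def content (μ : YoungDiagram) (T : SemistandardYoungTableau μ) (e : ℕ) : ℕ :=
  (μ.cells.filter fun c => T c.1 c.2 = e).card

/-- The coefficient of `x^α` in the Schur polynomial `s_μ(x_1, …, x_m)`: the number of
semistandard Young tableaux of shape `μ` with entries in `{0, …, m-1}` and content `α`. -/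
noncomputable def schurCoeff (m : ℕ) (μ : YoungDiagram) (α : Fin m → ℕ) : ℕ :=
  Nat.card {T : SemistandardYoungTableau μ // (∀ i j : ℕ, (i, j) ∈ μ → T i j < m) ∧
    ∀ k : Fin m, content μ T (k : ℕ) = α k}

/-- The Schur polynomial, viewed as its coefficient function. -/
noncomputable def schurR (m : ℕ) (μ : YoungDiagram) : (Fin m → ℕ) → ℝ :=
  fun α => (schurCoeff m μ α : ℝ)

/-- The support of a polynomial (given by its coefficient function), as a set of points of `ℝ^m`. -/
def Supp {m : ℕ} (F : (Fin m → ℕ) → ℝ) : Set (Fin m → ℝ) :=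
  {x | ∃ α : Fin m → ℕ, F α ≠ 0 ∧ x = fun i => (α i : ℝ)}

/-- The Newton polytope of a polynomial. -/
def NewtonP {m : ℕ} (F : (Fin m → ℕ) → ℝ) : Set (Fin m → ℝ) :=
  convexHull ℝ (Supp F)

/-- A lattice point of `ℝ^m`. -/
def IsLattice {m : ℕ} (x : Fin m → ℝ) : Prop := ∀ i, ∃ z : ℤ, x i = z

/-- Saturated Newton polytope. -/
def HasSNP {m : ℕ} (F : (Fin m → ℕ) → ℝ) : Prop :=
  NewtonP F ∩ {x | IsLattice x} = Supp F

/-- Integer decomposition property of a subset of `ℝ^m`. -/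
def HasIDP {m : ℕ} (P : Set (Fin m → ℝ)) : Prop :=
  ∀ t : ℕ, 0 < t → ∀ p ∈ (t : ℝ) • P, IsLattice p →
    ∃ v : Fin t → (Fin m → ℝ), (∀ j, v j ∈ P ∧ IsLattice (v j)) ∧ p = ∑ j, v j

/-- `b` dominates `a`: every partial sum of `b` is at least that of `a`. -/
def Dominates {m : ℕ} (a b : Fin m → ℕ) : Prop :=
  ∀ j : Fin m, ∑ i ∈ Finset.univ.filter (· ≤ j), a i ≤ ∑ i ∈ Finset.univ.filter (· ≤ j), b i

/-- The `S_m`-orbit of a point of `ℕ^m`, as a subset of `ℝ^m`. -/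
def orbitR {m : ℕ} (lam : Fin m → ℕ) : Set (Fin m → ℝ) :=
  {x | ∃ σ : Equiv.Perm (Fin m), x = fun i => (lam (σ i) : ℝ)}

/-- Add a box to row `r`. -/
def AddBoxAt {m : ℕ} (ν : Fin m → ℕ) (r : Fin m) : Fin m → ℕ :=
  Function.update ν r (ν r + 1)

/-- `ν'` is obtained from `ν` by adding a box in the northmost row such that the result is
a partition that is at most `β`. -/
def NorthmostStep {m : ℕ} (β ν ν' : Fin m → ℕ) : Prop :=
  ∃ r : Fin m, ν' = AddBoxAt ν r ∧ Antitone ν' ∧ ν' ≤ β ∧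
    ∀ r' : Fin m, r' < r → ¬ (Antitone (AddBoxAt ν r') ∧ AddBoxAt ν r' ≤ β)

/-- `f_λ^μ`: the number of semistandard fillings of the skew shape `λ/μ` (rows indexed by
`Fin m`, cells `μ i ≤ j < λ i`) whose `i`-th row entries lie in `[1, i]` (`0`-indexed rows,
so this is `[1, i-1]` for `1`-indexed rows as in the paper). -/
noncomputable def skewCount (m : ℕ) (lam μ : Fin m → ℕ) : ℕ :=
  Nat.card {T : Fin m → ℕ → ℕ //
    μ ≤ lam ∧
    (∀ i : Fin m, ∀ j : ℕ, ¬(μ i ≤ j ∧ j < lam i) → T i j = 0) ∧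
    (∀ i : Fin m, ∀ j₁ j₂ : ℕ, μ i ≤ j₁ → j₁ ≤ j₂ → j₂ < lam i → T i j₁ ≤ T i j₂) ∧
    (∀ i₁ i₂ : Fin m, i₁ < i₂ → ∀ j : ℕ, μ i₁ ≤ j → j < lam i₁ → μ i₂ ≤ j → j < lam i₂ →
      T i₁ j < T i₂ j) ∧
    (∀ i : Fin m, ∀ j : ℕ, μ i ≤ j → j < lam i → 1 ≤ T i j ∧ T i j ≤ (i : ℕ))}

/-- The coefficient function of the dual Grothendieck polynomial
`g_λ = ∑_μ f_λ^μ s_μ` in `m` variables. -/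
noncomputable def dualGrothendieck (m : ℕ) (lam : Fin m → ℕ) : (Fin m → ℕ) → ℝ :=
  fun α => ∑ μ ∈ Fintype.piFinset (fun i => Finset.range (lam i + 1)),
    if h : ∀ a b : Fin m, a ≤ b → μ b ≤ μ a then
      ((skewCount m lam μ * schurCoeff m (diagramOf μ fun _ _ hab => h _ _ hab) α : ℕ) : ℝ)
    else 0

/-! ### Arithmetic helpers -/

/-- Extension by zero. -/
def ext0 {m : ℕ} (f : Fin m → ℕ) : ℕ → ℕ := fun i => if h : i < m then f ⟨i, h⟩ else 0

lemma ext0_val {m : ℕ} (f : Fin m → ℕ) (i : Fin m) : ext0 f (i : ℕ) = f i := by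
  simp [ext0]

lemma ext0_ge {m : ℕ} (f : Fin m → ℕ) (i : ℕ) (h : m ≤ i) : ext0 f i = 0 := by
  simp [ext0, h]

lemma ext0_antitone {m : ℕ} (f : Fin m → ℕ) (hf : Antitone f) : Antitone (ext0 f) := by
  intro a b hab
  unfold ext0
  by_cases hb : b < m
  · have ha : a < m := by omega
    simp only [hb, ha, dite_true]
    exact hf (by simpa [Fin.le_def] using hab)
  · simp [hb]

lemma ext0_mono {m : ℕ} (f g : Fin m → ℕ) (h : f ≤ g) (i : ℕ) : ext0 f i ≤ ext0 g i := by
  unfold ext0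
  split_ifs with hi
  · exact h _
  · exact le_rfl

lemma sum_ext0 {m : ℕ} (f : Fin m → ℕ) : ∑ i ∈ range m, ext0 f i = ∑ i, f i := by
  rw [← Fin.sum_univ_eq_sum_range]
  simp [ext0_val]

lemma sum_map_val {m : ℕ} (a : ℕ → ℕ) (S : Finset (Fin m)) :
    ∑ i ∈ S, a (i : ℕ) = ∑ x ∈ S.map Fin.valEmbedding, a x := by
  simp [Finset.sum_map]

lemma map_val_subset {m : ℕ} (S : Finset (Fin m)) : S.map Fin.valEmbedding ⊆ range m := by
  intro x hx
  simp only [Finset.mem_map] at hx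
  obtain ⟨y, _, rfl⟩ := hx
  simp

lemma hermite (t : ℕ) (ht : 0 < t) (n : ℕ) : ∑ j ∈ range t, (n + j) / t = n := by
  induction n with
  | zero =>
    apply Finset.sum_eq_zero
    intro j hj
    rw [Finset.mem_range] at hj
    simp [Nat.div_eq_of_lt hj]
  | succ n ih =>
    have h1 := Finset.sum_range_succ (fun j => (n + j) / t) t
    have h2 := Finset.sum_range_succ' (fun j => (n + j) / t) t
    have h3 : ∑ j ∈ range t, (n + 1 + j) / t = ∑ j ∈ range t, (n + (j + 1)) / t :=
      Finset.sum_congr rfl fun j _ => by rw [add_assoc, add_comm 1 j]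
    simp only [add_zero] at h2
    have h4 : (n + t) / t = n / t + 1 := Nat.add_div_right n ht
    omega

lemma hinge (L : ℕ → ℕ) (q k : ℕ) (h1 : ∀ i < k, q ≤ L i) (h2 : ∀ i, k ≤ i → L i ≤ q) (r : ℕ) :
    ∑ i ∈ range r, L i + k * q ≤ ∑ i ∈ range k, L i + r * q := by
  rcases le_total r k with h | h
  · rw [← Finset.sum_range_add_sum_Ico L h]
    have : (k - r) * q ≤ ∑ i ∈ Ico r k, L i := by
      have := Finset.card_nsmul_le_sum (Ico r k) L q
        (fun i hi => h1 i (Finset.mem_Ico.mp hi).2)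
      simpa using this
    have e : k * q = (k - r) * q + r * q := by rw [← add_mul]; congr 1; omega
    omega
  · rw [← Finset.sum_range_add_sum_Ico L h]
    have : ∑ i ∈ Ico k r, L i ≤ (r - k) * q := by
      have := Finset.sum_le_card_nsmul (Ico k r) L q
        (fun i hi => h2 i (Finset.mem_Ico.mp hi).1)
      simpa using this
    have e : r * q = (r - k) * q + k * q := by rw [← add_mul]; congr 1; omega
    omega

lemma decomp_sorted (m t : ℕ) (ht : 0 < t) (L p : ℕ → ℕ) (hL : Antitone L) (hp : Antitone p)
    (hp0 : ∀ i, m ≤ i → p i = 0)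
    (h : ∀ k ≤ m, ∑ i ∈ range k, p i ≤ t * ∑ i ∈ range k, L i)
    (h0 : t * L 0 ≤ ∑ i ∈ range m, p i) :
    ∃ w : ℕ → ℕ → ℕ, (∀ j < t, (∀ S ⊆ range m, ∑ i ∈ S, w j i ≤ ∑ i ∈ range (#S), L i) ∧
      L 0 ≤ ∑ i ∈ range m, w j i) ∧ ∀ i, ∑ j ∈ range t, w j i = p i := by
  set P : ℕ → ℕ := fun k => ∑ i ∈ range k, p i with hP
  have hPs : ∀ i, P (i + 1) = P i + p i := fun i => Finset.sum_range_succ _ _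
  set w : ℕ → ℕ → ℕ := fun j i => (P (i + 1) + j) / t - (P i + j) / t with hw
  have hmono : ∀ j, Monotone (fun i => (P i + j) / t) := by
    intro j
    apply monotone_nat_of_le_succ
    intro i
    apply Nat.div_le_div_right
    have := hPs i
    omega
  have hsum : ∀ j < t, ∀ k, ∑ i ∈ range k, w j i = (P k + j) / t := by
    intro j hj k
    have := Finset.sum_range_tsub (hmono j) k
    simp only [hw]
    rw [this]
    simp [hP, Nat.div_eq_of_lt hj]
  refine ⟨w, ?_, ?_⟩
  · intro j hj
    refine ⟨?_, ?_⟩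
    · intro S hS
      rcases Nat.eq_zero_or_pos (#S) with hk | hk
      · rw [Finset.card_eq_zero] at hk
        simp [hk]
      set k := #S with hkdef
      set q := L (k - 1) with hq
      have hex : ∃ r, p r ≤ t * q := ⟨m, by rw [hp0 m le_rfl]; exact Nat.zero_le _⟩
      set r := Nat.find hex with hr
      have hr1 : p r ≤ t * q := Nat.find_spec hex
      have hr2 : ∀ i < r, t * q < p i := fun i hi => not_le.mp (Nat.find_min hex hi)
      have hrm : r ≤ m := Nat.find_min' hex (by rw [hp0 m le_rfl]; exact Nat.zero_le _)
      have hr3 : ∀ i, r ≤ i → p i ≤ t * q := fun i hi => (hp hi).trans hr1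
      have hlow : ∀ i, t * q ≤ p i → q ≤ w j i := by
        intro i hi
        have : (P i + j + t * q) / t ≤ (P (i + 1) + j) / t :=
          Nat.div_le_div_right (by have := hPs i; omega)
        rw [Nat.add_mul_div_left _ _ ht] at this
        simp only [hw]
        omega
      have hupp : ∀ i, p i ≤ t * q → w j i ≤ q := by
        intro i hi
        have : (P (i + 1) + j) / t ≤ (P i + j + t * q) / t :=
          Nat.div_le_div_right (by have := hPs i; omega)
        rw [Nat.add_mul_div_left _ _ ht] at this
        simp only [hw]
        omega
      have e1 : ∑ i ∈ S, w j i ≤ k * q + ∑ i ∈ S, (w j i - q) := by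
        calc ∑ i ∈ S, w j i ≤ ∑ i ∈ S, (q + (w j i - q)) :=
              Finset.sum_le_sum fun i _ => by omega
          _ = _ := by rw [Finset.sum_add_distrib]; simp [hkdef]
      have e2 : ∑ i ∈ S, (w j i - q) ≤ ∑ i ∈ range m, (w j i - q) :=
        Finset.sum_le_sum_of_subset hS
      have e3 : ∑ i ∈ range m, (w j i - q) = ∑ i ∈ range r, (w j i - q) := by
        symm
        apply Finset.sum_subset (Finset.range_mono hrm)
        intro i _ hi
        simp only [Finset.mem_range, not_lt] at hi
        have := hupp i (hr3 i hi)
        omega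
      have e4 : ∑ i ∈ range r, w j i = ∑ i ∈ range r, (w j i - q) + r * q := by
        have : ∑ i ∈ range r, w j i = ∑ i ∈ range r, ((w j i - q) + q) := by
          apply Finset.sum_congr rfl
          intro i hi
          have := hlow i (hr2 i (Finset.mem_range.mp hi)).le
          omega
        rw [this, Finset.sum_add_distrib]
        simp
      have e5 : (P r + j) / t ≤ ∑ i ∈ range r, L i := by
        have h1 := h r hrm
        have : (P r + j) / t < ∑ i ∈ range r, L i + 1 := by
          rw [Nat.div_lt_iff_lt_mul ht, mul_comm, mul_add]
          simp only [hP]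
          omega
        omega
      rw [← hsum j hj r] at e5
      have e6 := hinge L q k (fun i hi => hL (by omega))
        (fun i hi => hL (by omega)) r
      omega
    · rw [hsum j hj, Nat.le_div_iff_mul_le ht, mul_comm]
      simp only [hP]
      omega
  · intro i
    have h1 := hermite t ht (P (i + 1))
    have h2 := hermite t ht (P i)
    have h3 : ∑ j ∈ range t, w j i + ∑ j ∈ range t, (P i + j) / t
        = ∑ j ∈ range t, (P (i + 1) + j) / t := by
      rw [← Finset.sum_add_distrib]
      apply Finset.sum_congr rfl
      intro j _
      have := hmono j (Nat.le_succ i)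
      simp only [hw]
      simp only [Nat.succ_eq_add_one] at this
      omega
    have := hPs i
    omega

/-- The lattice points of the generalized polymatroid. -/
def InP {m : ℕ} (L : ℕ → ℕ) (a : Fin m → ℕ) : Prop :=
  (∀ S : Finset (Fin m), ∑ i ∈ S, a i ≤ ∑ i ∈ range (#S), L i) ∧ L 0 ≤ ∑ i, a i

lemma decomp {m : ℕ} (t : ℕ) (ht : 0 < t) (L : ℕ → ℕ) (hL : Antitone L) (p : Fin m → ℕ)
    (h : ∀ S : Finset (Fin m), ∑ i ∈ S, p i ≤ t * ∑ i ∈ range (#S), L i)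
    (h0 : t * L 0 ≤ ∑ i, p i) :
    ∃ v : Fin t → Fin m → ℕ, (∀ j, InP L (v j)) ∧ ∀ i, p i = ∑ j, v j i := by
  obtain ⟨σ, hσ⟩ : ∃ σ : Equiv.Perm (Fin m), Antitone (p ∘ σ) := by
    refine ⟨Tuple.sort (OrderDual.toDual ∘ p), ?_⟩
    intro a b hab
    exact Tuple.monotone_sort (OrderDual.toDual ∘ p) hab
  have hk : ∀ k ≤ m, ∑ i ∈ range k, ext0 (p ∘ σ) i ≤ t * ∑ i ∈ range k, L i := by
    intro k hk
    have hb : ∀ i ∈ range k, i < m := fun i hi => lt_of_lt_of_le (Finset.mem_range.mp hi) hk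
    have e := h (((range k).attachFin hb).map σ.toEmbedding)
    rw [Finset.card_map, Finset.card_attachFin, Finset.card_range, Finset.sum_map] at e
    refine le_trans (le_of_eq ?_) e
    have e2 := sum_map_val (ext0 (p ∘ σ)) ((range k).attachFin hb)
    rw [Finset.map_valEmbedding_attachFin] at e2
    rw [← e2]
    exact Finset.sum_congr rfl fun i _ => by rw [ext0_val]; rfl
  obtain ⟨w, hw1, hw2⟩ := decomp_sorted m t ht L (ext0 (p ∘ σ)) hL (ext0_antitone _ hσ)
    (fun i hi => ext0_ge _ i hi) hk (by
      rw [sum_ext0]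
      have : ∑ i, (p ∘ σ) i = ∑ i, p i := Equiv.sum_comp σ p
      omega)
  refine ⟨fun j i => w j (σ.symm i : Fin m), ?_, ?_⟩
  · intro j
    obtain ⟨a1, a2⟩ := hw1 j j.isLt
    refine ⟨?_, ?_⟩
    · intro S
      have e := a1 ((S.map σ.symm.toEmbedding).map Fin.valEmbedding) (map_val_subset _)
      rw [← sum_map_val, Finset.card_map, Finset.card_map, Finset.sum_map] at e
      exact e
    · rw [← Fin.sum_univ_eq_sum_range] at a2
      rw [Equiv.sum_comp σ.symm (fun i : Fin m => w j i)]
      exact a2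
  · intro i
    have := hw2 (σ.symm i : Fin m)
    rw [ext0_val] at this
    rw [Fin.sum_univ_eq_sum_range (fun j => w j (σ.symm i : Fin m)) t, this]
    simp

/-! ### Existence of tableaux -/

lemma exists_tableau (n : ℕ) : ∀ (μ α : ℕ → ℕ), Antitone μ → (∀ i, n ≤ i → μ i = 0) →
    (∀ S ⊆ range n, ∑ i ∈ S, α i ≤ ∑ i ∈ range (#S), μ i) →
    (∑ i ∈ range n, α i = ∑ i ∈ range n, μ i) →
    ∃ T : ℕ → ℕ → ℕ, (∀ i j, j < μ i → T i j < n) ∧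
      (∀ i j₁ j₂, j₁ < j₂ → j₂ < μ i → T i j₁ ≤ T i j₂) ∧
      (∀ i₁ i₂ j, i₁ < i₂ → j < μ i₂ → T i₁ j < T i₂ j) ∧
      (∀ k < n, ∑ i ∈ range n, #{j ∈ range (μ i) | T i j = k} = α k) := by
  induction n with
  | zero =>
    intro μ α _ h0 _ _
    refine ⟨fun _ _ => 0, ?_, ?_, ?_, ?_⟩
    · intro i j h; rw [h0 i (Nat.zero_le _)] at h; omega
    · intros; exact le_rfl
    · intro i₁ i j _ h; rw [h0 i (Nat.zero_le _)] at h; omega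
    · intro k hk; omega
  | succ n ih =>
    intro μ α hμ h0 hS hsum
    set a := α n with ha
    have ha0 : a ≤ μ 0 := by
      have := hS {n} (by simp)
      simpa using this
    have han : μ n ≤ a := by
      have := hS (range n) (Finset.range_mono (Nat.le_succ n))
      rw [Finset.card_range] at this
      rw [Finset.sum_range_succ, Finset.sum_range_succ] at hsum
      omega
    set ν : ℕ → ℕ := fun i => if a ≤ μ (i + 1) then μ i else if a ≤ μ i then μ i + μ (i + 1) - a
      else μ (i + 1) with hν
    have hstep : ∀ i, μ (i + 1) ≤ μ i := fun i => hμ (Nat.le_succ i)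
    have hν1 : ∀ i, ν i ≤ μ i := by
      intro i; have := hstep i; simp only [hν]; split_ifs <;> omega
    have hν2 : ∀ i, μ (i + 1) ≤ ν i := by
      intro i; have := hstep i; simp only [hν]; split_ifs <;> omega
    have hνa : Antitone ν := antitone_nat_of_succ_le fun i => (hν1 (i + 1)).trans (hν2 i)
    have hν0 : ∀ i, n ≤ i → ν i = 0 := by
      intro i hi
      have h1 : μ (i + 1) = 0 := h0 _ (by omega)
      have h2 : μ i ≤ a := (hμ hi).trans han
      simp only [hν, h1]
      split_ifs <;> omega
    have hN : ∀ k, (a ≤ μ k → ∑ i ∈ range k, ν i = ∑ i ∈ range k, μ i) ∧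
        (μ k ≤ a → ∑ i ∈ range k, ν i + a = ∑ i ∈ range (k + 1), μ i) := by
      intro k
      induction k with
      | zero =>
        refine ⟨fun _ => by simp, fun h => ?_⟩
        simp; omega
      | succ k ihk =>
        have h1 := hstep k
        have h2 : ν k = if a ≤ μ (k + 1) then μ k else if a ≤ μ k then μ k + μ (k + 1) - a
          else μ (k + 1) := rfl
        rw [Finset.sum_range_succ μ (k + 1), Finset.sum_range_succ μ k, Finset.sum_range_succ ν k]
        rw [Finset.sum_range_succ μ k] at ihk
        refine ⟨fun h => ?_, fun h => ?_⟩
        · have := ihk.1 (by omega)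
          rw [if_pos h] at h2
          omega
        · by_cases h3 : a ≤ μ k
          · have := ihk.1 h3
            split_ifs at h2 <;> omega
          · have := ihk.2 (by omega)
            split_ifs at h2 <;> omega
    have hNn := (hN n).2 han
    have hS' : ∀ S ⊆ range n, ∑ i ∈ S, α i ≤ ∑ i ∈ range (#S), ν i := by
      intro S hSn
      rcases le_total a (μ (#S)) with h | h
      · rw [(hN _).1 h]
        exact hS S (hSn.trans (Finset.range_mono (Nat.le_succ n)))
      · have h1 := (hN _).2 h
        have hnS : n ∉ S := fun hn => by simpa using hSn hn
        have h2 := hS (insert n S) (by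
          intro x hx
          rw [Finset.mem_insert] at hx
          rcases hx with rfl | hx
          · simp
          · exact Finset.range_mono (Nat.le_succ n) (hSn hx))
        rw [Finset.sum_insert hnS, Finset.card_insert_of_notMem hnS] at h2
        omega
    obtain ⟨T, t1, t2, t3, t4⟩ := ih ν α hνa hν0 hS' (by
      rw [Finset.sum_range_succ] at hsum
      omega)
    refine ⟨fun i j => if j < ν i then T i j else n, ?_, ?_, ?_, ?_⟩
    · intro i j _
      dsimp only
      split_ifs with h
      · have := t1 i j h; omega
      · omega
    · intro i j₁ j₂ hj hj2
      dsimp only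
      split_ifs with h1 h2 h2
      · exact t2 i j₁ j₂ hj h2
      · exact (t1 i j₁ h1).le
      · omega
      · exact le_rfl
    · intro i₁ i₂ j hi hj
      dsimp only
      have h1 : j < ν i₁ := lt_of_lt_of_le hj ((hμ (show i₁ + 1 ≤ i₂ from hi)).trans (hν2 i₁))
      rw [if_pos h1]
      split_ifs with h2
      · exact t3 i₁ i₂ j hi h2
      · exact t1 i₁ j h1
    · intro k hk
      have hrow : ∀ i, #{j ∈ range (μ i) | (if j < ν i then T i j else n) = k}
          = if k < n then #{j ∈ range (ν i) | T i j = k} else μ i - ν i := by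
        intro i
        split_ifs with hkn
        · congr 1
          ext j
          simp only [Finset.mem_filter, Finset.mem_range]
          have := hν1 i
          constructor
          · rintro ⟨h1, h2⟩
            split_ifs at h2 with h3
            · exact ⟨h3, h2⟩
            · omega
          · rintro ⟨h1, h2⟩
            rw [if_pos h1]
            exact ⟨by omega, h2⟩
        · have hkn' : k = n := by omega
          rw [← Nat.card_Ico]
          congr 1
          ext j
          simp only [Finset.mem_filter, Finset.mem_range, Finset.mem_Ico]
          constructor
          · rintro ⟨h1, h2⟩
            split_ifs at h2 with h3
            · have := t1 i j h3; omega
            · omega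
          · rintro ⟨h1, h2⟩
            rw [if_neg (by omega)]
            exact ⟨h2, hkn'.symm⟩
      rw [Finset.sum_congr rfl fun i _ => hrow i]
      by_cases hkn : k < n
      · simp only [hkn, if_true]
        rw [Finset.sum_range_succ, hν0 n le_rfl, t4 k hkn]
        simp
      · have hkn' : k = n := by omega
        simp only [hkn, if_false]
        have e : ∑ i ∈ range (n + 1), (μ i - ν i) + ∑ i ∈ range (n + 1), ν i
            = ∑ i ∈ range (n + 1), μ i := by
          rw [← Finset.sum_add_distrib]
          exact Finset.sum_congr rfl fun i _ => by have := hν1 i; omega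
        rw [Finset.sum_range_succ ν, hν0 n le_rfl] at e
        rw [hkn']
        omega

lemma mem_diagramOf {m : ℕ} (μ : Fin m → ℕ) (h : Antitone μ) (i j : ℕ) :
    (i, j) ∈ diagramOf μ h ↔ j < ext0 μ i := by
  rw [← YoungDiagram.mem_cells]
  simp only [diagramOf, Finset.mem_biUnion, Finset.mem_univ, true_and, Finset.mem_image,
    Finset.mem_range, Prod.mk.injEq]
  constructor
  · rintro ⟨i', j', h1, rfl, rfl⟩
    rwa [ext0_val]
  · intro hj
    unfold ext0 at hj
    split_ifs at hj with hi
    · exact ⟨⟨i, hi⟩, j, hj, rfl, rfl⟩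
    · omega

lemma content_diagramOf {m : ℕ} (μ : Fin m → ℕ) (h : Antitone μ)
    (T : SemistandardYoungTableau (diagramOf μ h)) (k : ℕ) :
    content _ T k = ∑ i ∈ range m, #{j ∈ range (ext0 μ i) | T i j = k} := by
  unfold content
  rw [Finset.card_eq_sum_card_fiberwise (f := Prod.fst) (t := range m)]
  · apply Finset.sum_congr rfl
    intro i _
    symm
    apply Finset.card_bij (fun j _ => (i, j))
    · intro j hj
      simp only [Finset.mem_filter, Finset.mem_range] at hj
      simp only [Finset.mem_filter, YoungDiagram.mem_cells, mem_diagramOf]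
      exact ⟨hj, trivial⟩
    · intro a _ b _ hab
      exact (Prod.mk.inj hab).2
    · rintro ⟨i', j⟩ hb
      simp only [Finset.mem_filter, YoungDiagram.mem_cells, mem_diagramOf] at hb
      obtain ⟨hb, rfl⟩ := hb
      refine ⟨j, ?_, rfl⟩
      simpa using hb
  · rintro ⟨i, j⟩ hb
    simp only [Finset.coe_filter, Set.mem_setOf_eq, YoungDiagram.mem_cells, mem_diagramOf] at hb
    simp only [Finset.coe_range, Set.mem_Iio]
    by_contra hi
    rw [ext0_ge _ _ (not_lt.mp hi)] at hb
    omega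

lemma schur_finite (m : ℕ) (μ : YoungDiagram) (α : Fin m → ℕ) :
    Finite {T : SemistandardYoungTableau μ // (∀ i j : ℕ, (i, j) ∈ μ → T i j < m) ∧
      ∀ k : Fin m, content μ T (k : ℕ) = α k} := by
  apply Finite.of_injective (β := μ.cells → Fin m)
    (fun T c => ⟨T.1 c.1.1 c.1.2, T.2.1 _ _ c.2⟩)
  intro T T' hTT
  apply Subtype.ext
  ext i j
  by_cases hc : (i, j) ∈ μ
  · have := congrFun hTT ⟨(i, j), hc⟩
    simpa using this
  · rw [T.1.zeros hc, T'.1.zeros hc]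

lemma schurCoeff_ne_zero_of {m : ℕ} (μ : Fin m → ℕ) (h : Antitone μ) (α : Fin m → ℕ)
    (hS : ∀ S : Finset (Fin m), ∑ i ∈ S, α i ≤ ∑ i ∈ range (#S), ext0 μ i)
    (hsum : ∑ i, α i = ∑ i, μ i) : schurCoeff m (diagramOf μ h) α ≠ 0 := by
  obtain ⟨T, t1, t2, t3, t4⟩ := exists_tableau m (ext0 μ) (ext0 α) (ext0_antitone μ h)
    (fun i hi => ext0_ge _ i hi) (by
      intro S hSm
      have hb : ∀ i ∈ S, i < m := fun i hi => Finset.mem_range.mp (hSm hi)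
      have e := hS (S.attachFin hb)
      rw [Finset.card_attachFin] at e
      have e2 := sum_map_val (ext0 α) (S.attachFin hb)
      rw [Finset.map_valEmbedding_attachFin] at e2
      rw [← e2]
      simpa [ext0_val] using e) (by rw [sum_ext0, sum_ext0, hsum])
  have := schur_finite m (diagramOf μ h) α
  unfold schurCoeff
  rw [Nat.card_ne_zero]
  refine ⟨⟨⟨⟨fun i j => if j < ext0 μ i then T i j else 0, ?_, ?_, ?_⟩, ?_, ?_⟩⟩, this⟩
  · intro i j1 j2 hj hc
    rw [mem_diagramOf] at hc
    rw [if_pos hc, if_pos (by omega)]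
    exact t2 i j1 j2 hj hc
  · intro i1 i2 j hi hc
    rw [mem_diagramOf] at hc
    rw [if_pos hc, if_pos (lt_of_lt_of_le hc (ext0_antitone μ h hi.le))]
    exact t3 i1 i2 j hi hc
  · intro i j hc
    rw [mem_diagramOf] at hc
    rw [if_neg hc]
  · intro i j hc
    rw [mem_diagramOf] at hc
    change (if j < ext0 μ i then T i j else 0) < m
    rw [if_pos hc]
    exact t1 i j hc
  · intro k
    rw [content_diagramOf, ← ext0_val α k, ← t4 k k.isLt]
    apply Finset.sum_congr rfl
    intro i _
    congr 1
    apply Finset.filter_congr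
    intro j hj
    change (if j < ext0 μ i then T i j else 0) = _ ↔ _
    rw [if_pos (Finset.mem_range.mp hj)]

lemma card_entries_le (μ : YoungDiagram) (T : SemistandardYoungTableau μ) (L : ℕ → ℕ)
    (hL : ∀ i j, (i, j) ∈ μ → j < L i) (S : Finset ℕ) :
    #{c ∈ μ.cells | T c.1 c.2 ∈ S} ≤ ∑ i ∈ range (#S), L i := by
  have e : ∑ i ∈ range (#S), L i = #((range (#S)).sigma fun i => range (L i)) := by
    simp [Finset.card_sigma]
  rw [e]
  have hlt : ∀ i i' j, i < i' → (i', j) ∈ μ → T i j < T i' j :=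
    fun i i' j h hc => T.col_strict h hc
  apply Finset.card_le_card_of_injOn
    (fun c => (⟨#{i ∈ range c.1 | T i c.2 ∈ S}, c.2⟩ : Σ _ : ℕ, ℕ))
  · rintro ⟨i, j⟩ hc
    simp only [Finset.coe_filter, Set.mem_setOf_eq, YoungDiagram.mem_cells] at hc
    obtain ⟨hc, hcS⟩ := hc
    simp only [Finset.mem_coe, Finset.mem_sigma, Finset.mem_range]
    constructor
    · have : #{i' ∈ range i | T i' j ∈ S} ≤ #(S.erase (T i j)) := by
        apply Finset.card_le_card_of_injOn (fun i' => T i' j)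
        · intro i' hi'
          simp only [Finset.coe_filter, Set.mem_setOf_eq, Finset.mem_range] at hi'
          simp only [Finset.mem_coe, Finset.mem_erase]
          exact ⟨(hlt i' i j hi'.1 hc).ne, hi'.2⟩
        · intro x hx y hy hxy
          simp only [Finset.coe_filter, Set.mem_setOf_eq, Finset.mem_range] at hx hy
          dsimp only at hxy
          rcases lt_trichotomy x y with h | h | h
          · have := hlt x y j h (μ.up_left_mem hy.1.le le_rfl hc); omega
          · exact h
          · have := hlt y x j h (μ.up_left_mem hx.1.le le_rfl hc); omega
      have h2 := Finset.card_erase_lt_of_mem hcS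
      omega
    · apply hL
      apply μ.up_left_mem _ le_rfl hc
      have := Finset.card_filter_le (range i) (fun i' => T i' j ∈ S)
      simpa using this
  · have key : ∀ i i' j, T i j ∈ S → i < i' →
        #{x ∈ range i | T x j ∈ S} < #{x ∈ range i' | T x j ∈ S} := by
      intro i i' j hi hii
      apply Finset.card_lt_card
      rw [Finset.ssubset_iff_of_subset]
      · exact ⟨i, by simp [hi, hii], by simp⟩
      · apply Finset.filter_subset_filter
        exact Finset.range_mono hii.le
    rintro ⟨i, j⟩ hc ⟨i', j'⟩ hc' heq
    simp only [Finset.coe_filter, Set.mem_setOf_eq, YoungDiagram.mem_cells] at hc hc'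
    simp only [Sigma.mk.injEq, heq_eq_eq] at heq
    obtain ⟨h1, rfl⟩ := heq
    rcases lt_trichotomy i i' with h | h | h
    · have := key i i' j hc.2 h; omega
    · rw [h]
    · have := key i' i j hc'.2 h; omega

lemma sum_content (μ : YoungDiagram) (T : SemistandardYoungTableau μ) (S : Finset ℕ) :
    ∑ k ∈ S, content μ T k = #{c ∈ μ.cells | T c.1 c.2 ∈ S} := by
  rw [Finset.card_eq_sum_card_fiberwise (f := fun c => T c.1 c.2) (t := S)]
  · apply Finset.sum_congr rfl
    intro k hk
    unfold content
    congr 1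
    ext c
    simp only [Finset.mem_filter]
    constructor
    · rintro ⟨h1, h2⟩
      exact ⟨⟨h1, h2 ▸ hk⟩, h2⟩
    · rintro ⟨⟨h1, _⟩, h2⟩
      exact ⟨h1, h2⟩
  · intro c hc
    simp only [Finset.coe_filter, Set.mem_setOf_eq] at hc
    exact hc.2

lemma inP_of_schurCoeff {m : ℕ} (lam μ : Fin m → ℕ) (h : Antitone μ) (hle : μ ≤ lam)
    (hlow : (fun k : Fin m => if (k : ℕ) = 0 then lam k else 0) ≤ μ) (α : Fin m → ℕ)
    (hs : schurCoeff m (diagramOf μ h) α ≠ 0) : InP (ext0 lam) α := by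
  unfold schurCoeff at hs
  rw [Nat.card_ne_zero] at hs
  obtain ⟨⟨⟨T, hT1, hT2⟩⟩, _⟩ := hs
  have hα : ∀ S : Finset (Fin m), ∑ i ∈ S, α i
      = #{c ∈ (diagramOf μ h).cells | T c.1 c.2 ∈ S.map Fin.valEmbedding} := by
    intro S
    rw [← sum_content, ← sum_map_val]
    exact Finset.sum_congr rfl fun i _ => (hT2 i).symm
  refine ⟨?_, ?_⟩
  · intro S
    rw [hα S]
    have := card_entries_le _ T (ext0 lam) (fun i j hc => by
      rw [mem_diagramOf] at hc
      exact lt_of_lt_of_le hc (ext0_mono μ lam hle i)) (S.map Fin.valEmbedding)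
    rwa [Finset.card_map] at this
  · rw [hα univ]
    rcases Nat.eq_zero_or_pos m with hm | hm
    · rw [ext0_ge _ _ (by omega)]; exact Nat.zero_le _
    · have h0 : ext0 lam 0 ≤ ext0 μ 0 := by
        have := hlow ⟨0, hm⟩
        simpa [ext0, hm] using this
      calc ext0 lam 0 = #(range (ext0 lam 0)) := by simp
        _ ≤ _ := by
          apply Finset.card_le_card_of_injOn (fun j => (0, j))
          · intro j hj
            simp only [Finset.coe_range, Set.mem_Iio] at hj
            have hc : (0, j) ∈ diagramOf μ h := by
              rw [mem_diagramOf]; omega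
            simp only [Finset.coe_filter, Set.mem_setOf_eq, YoungDiagram.mem_cells]
            refine ⟨hc, ?_⟩
            rw [Finset.mem_map]
            exact ⟨⟨_, hT1 _ _ hc⟩, Finset.mem_univ _, rfl⟩
          · intro a _ b _ hab
            exact (Prod.mk.inj hab).2

lemma exists_shape {m : ℕ} (lam : Fin m → ℕ) (hlam : Antitone lam) (α : Fin m → ℕ)
    (hα : InP (ext0 lam) α) : ∃ (μ : Fin m → ℕ) (h : Antitone μ), μ ≤ lam ∧
      (fun k : Fin m => if (k : ℕ) = 0 then lam k else 0) ≤ μ ∧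
      schurCoeff m (diagramOf μ h) α ≠ 0 := by
  obtain ⟨h1, h2⟩ := hα
  set n := ∑ i, α i with hn
  set L := ext0 lam with hL
  have hLa : Antitone L := ext0_antitone lam hlam
  set M : ℕ → ℕ := fun i => min (L i) (n - ∑ k ∈ range i, L k) with hM
  have hMa : Antitone M := by
    apply antitone_nat_of_succ_le
    intro i
    have := hLa (Nat.le_succ i)
    simp only [hM, Nat.succ_eq_add_one] at this ⊢
    rw [Finset.sum_range_succ]
    omega
  have hMs : ∀ k, ∑ i ∈ range k, M i = min (∑ i ∈ range k, L i) n := by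
    intro k
    induction k with
    | zero => simp
    | succ k ih =>
      rw [Finset.sum_range_succ, Finset.sum_range_succ, ih]
      simp only [hM]
      omega
  set μ : Fin m → ℕ := fun i => M i with hμ
  have hext : ext0 μ = M := by
    funext i
    by_cases hi : i < m
    · simp [ext0, hi, hμ]
    · rw [ext0_ge _ _ (not_lt.mp hi)]
      simp only [hM, hL, ext0_ge lam i (not_lt.mp hi)]
      simp
  refine ⟨μ, fun a b hab => hMa hab, ?_, ?_, ?_⟩
  · intro i
    have : M i ≤ L i := min_le_left _ _
    rwa [hL, ext0_val] at this
  · intro i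
    dsimp only
    split_ifs with hi
    · have e : L (i : ℕ) = lam i := ext0_val lam i
      simp only [hμ, hM, e, hi, Finset.range_zero, Finset.sum_empty]
      rw [hi] at e
      omega
    · exact Nat.zero_le _
  · apply schurCoeff_ne_zero_of
    · intro S
      rw [hext, hMs]
      apply le_min (h1 S)
      exact Finset.sum_le_sum_of_subset (Finset.subset_univ S)
    · rw [← sum_ext0 μ, hext, hMs, ← hn]
      have := h1 univ
      rw [Finset.card_univ, Fintype.card_fin] at this
      exact (min_eq_right this).symm

/-! ### The coefficients -/

lemma skewCount_ne_zero_iff (m : ℕ) (lam : Fin m → ℕ) (μ : Fin m → ℕ) :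
    skewCount m lam μ ≠ 0 ↔
        ((fun k : Fin m => if (k : ℕ) = 0 then lam k else 0) ≤ μ ∧ μ ≤ lam) := by
  unfold skewCount
  rw [Nat.card_ne_zero]
  constructor
  · rintro ⟨⟨⟨T, h1, h2, h3, h4, h5⟩⟩, _⟩
    refine ⟨?_, h1⟩
    intro k
    dsimp only
    split_ifs with hk
    · by_contra hlt
      have := h5 k (μ k) le_rfl (not_le.mp hlt)
      omega
    · exact Nat.zero_le _
  · rintro ⟨h1, h2⟩
    refine ⟨⟨⟨fun i j => if μ i ≤ j ∧ j < lam i then (i : ℕ) else 0, h2, ?_, ?_, ?_, ?_⟩⟩, ?_⟩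
    · intro i j h
      exact if_neg h
    · intro i j₁ j₂ a b c
      dsimp only
      rw [if_pos ⟨by omega, by omega⟩, if_pos ⟨by omega, by omega⟩]
    · intro i₁ i₂ hi j a b c d
      dsimp only
      rw [if_pos ⟨a, b⟩, if_pos ⟨c, d⟩]
      exact hi
    · intro i j a b
      dsimp only
      rw [if_pos ⟨a, b⟩]
      refine ⟨?_, le_rfl⟩
      by_contra hi
      have hi0 : (i : ℕ) = 0 := by omega
      have := h1 i
      simp only [hi0, if_true] at this
      omega
    · apply Finite.of_injective (β := (i : Fin m) → Fin (lam i) → Fin (m + 1))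
        (fun T i j => ⟨T.1 i j, by
          obtain ⟨T, _, b, _, _, e⟩ := T
          have hi := i.isLt
          by_cases h : μ i ≤ j ∧ (j : ℕ) < lam i
          · have := e i j h.1 h.2
            dsimp only
            omega
          · have := b i j h
            dsimp only
            omega⟩)
      rintro ⟨T, a⟩ ⟨T', a'⟩ hTT
      apply Subtype.ext
      funext i j
      dsimp only
      by_cases h : j < lam i
      · have := congrFun (congrFun hTT i) ⟨j, h⟩
        simpa using this
      · rw [a.2.1 i j (fun hh => h hh.2), a'.2.1 i j (fun hh => h hh.2)]

lemma dualGrothendieck_ne_zero_iff (m : ℕ) (lam : Fin m → ℕ) (hlam : Antitone lam)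
    (α : Fin m → ℕ) : dualGrothendieck m lam α ≠ 0 ↔ InP (ext0 lam) α := by
  unfold dualGrothendieck
  have hnn : ∀ μ ∈ Fintype.piFinset (fun i => Finset.range (lam i + 1)),
      0 ≤ (if h : ∀ a b : Fin m, a ≤ b → μ b ≤ μ a then
      ((skewCount m lam μ * schurCoeff m (diagramOf μ fun _ _ hab => h _ _ hab) α : ℕ) : ℝ)
    else 0) := by
    intro μ _
    split_ifs
    · exact Nat.cast_nonneg _
    · exact le_rfl
  rw [Ne, Finset.sum_eq_zero_iff_of_nonneg hnn]
  push Not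
  constructor
  · rintro ⟨μ, _, hμ⟩
    split_ifs at hμ with h
    · rw [Nat.cast_ne_zero, mul_ne_zero_iff, skewCount_ne_zero_iff] at hμ
      exact inP_of_schurCoeff lam μ (fun _ _ hab => h _ _ hab) hμ.1.2 hμ.1.1 α hμ.2
    · exact absurd rfl hμ
  · intro hα
    obtain ⟨μ, h, h1, h2, h3⟩ := exists_shape lam hlam α hα
    refine ⟨μ, ?_, ?_⟩
    · rw [Fintype.mem_piFinset]
      intro i
      rw [Finset.mem_range]
      exact Nat.lt_succ_of_le (h1 i)
    · rw [dif_pos (fun a b hab => h hab), Nat.cast_ne_zero, mul_ne_zero_iff,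
        skewCount_ne_zero_iff]
      exact ⟨⟨h2, h1⟩, h3⟩

lemma newton_subset (m : ℕ) (lam : Fin m → ℕ) (hlam : Antitone lam) (x : Fin m → ℝ)
    (hx : x ∈ NewtonP (dualGrothendieck m lam)) :
    (∀ i, 0 ≤ x i) ∧ (∀ S : Finset (Fin m), ∑ i ∈ S, x i ≤ (∑ i ∈ range (#S), ext0 lam i : ℕ)) ∧
      ((ext0 lam 0 : ℕ) : ℝ) ≤ ∑ i, x i := by
  set Q : Set (Fin m → ℝ) := {x | (∀ i, 0 ≤ x i) ∧
    (∀ S : Finset (Fin m), ∑ i ∈ S, x i ≤ (∑ i ∈ range (#S), ext0 lam i : ℕ)) ∧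
      ((ext0 lam 0 : ℕ) : ℝ) ≤ ∑ i, x i} with hQ
  have hconv : Convex ℝ Q := by
    rintro x ⟨hx1, hx2, hx3⟩ y ⟨hy1, hy2, hy3⟩ a b ha hb hab
    have hs : ∀ S : Finset (Fin m), ∑ i ∈ S, (a • x + b • y) i
        = a * ∑ i ∈ S, x i + b * ∑ i ∈ S, y i := by
      intro S
      simp [Finset.sum_add_distrib, Finset.mul_sum]
    refine ⟨?_, ?_, ?_⟩
    · intro i
      have := mul_nonneg ha (hx1 i)
      have := mul_nonneg hb (hy1 i)
      simp only [Pi.add_apply, Pi.smul_apply, smul_eq_mul]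
      linarith
    · intro S
      rw [hs]
      have h1 := mul_le_mul_of_nonneg_left (hx2 S) ha
      have h2 := mul_le_mul_of_nonneg_left (hy2 S) hb
      calc _ ≤ _ := add_le_add h1 h2
        _ = _ := by rw [← add_mul, hab, one_mul]
    · rw [hs]
      have h1 := mul_le_mul_of_nonneg_left hx3 ha
      have h2 := mul_le_mul_of_nonneg_left hy3 hb
      calc ((ext0 lam 0 : ℕ) : ℝ) = a * (ext0 lam 0 : ℕ) + b * (ext0 lam 0 : ℕ) := by
            rw [← add_mul, hab, one_mul]
        _ ≤ _ := add_le_add h1 h2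
  have hsub : Supp (dualGrothendieck m lam) ⊆ Q := by
    rintro _ ⟨α, hα, rfl⟩
    rw [dualGrothendieck_ne_zero_iff m lam hlam] at hα
    refine ⟨fun i => Nat.cast_nonneg _, ?_, ?_⟩
    · intro S
      have := hα.1 S
      dsimp only
      exact_mod_cast this
    · have := hα.2
      dsimp only
      exact_mod_cast this
  exact convexHull_min hsub hconv hx

lemma nat_of_lattice {m : ℕ} (x : Fin m → ℝ) (hx : IsLattice x) (h0 : ∀ i, 0 ≤ x i) :
    ∃ α : Fin m → ℕ, x = fun i => (α i : ℝ) := by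
  choose z hz using hx
  refine ⟨fun i => (z i).toNat, ?_⟩
  funext i
  have h := h0 i
  rw [hz i] at h ⊢
  have h' : 0 ≤ z i := by exact_mod_cast h
  have : ((z i).toNat : ℤ) = z i := Int.toNat_of_nonneg h'
  exact_mod_cast this.symm

lemma lattice_of_nat {m : ℕ} (α : Fin m → ℕ) : IsLattice (fun i => (α i : ℝ)) :=
  fun i => ⟨α i, by simp⟩

/-- The dual Grothendieck polynomial `g_λ = ∑_μ f_λ^μ s_μ` has `f_λ^μ ≠ 0` exactly for
partitions `μ` with `(λ₁,0,…,0) ≤ μ ≤ λ` componentwise; consequently `g_λ` has saturated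
Newton polytope and `Newton(g_λ)` has the integer decomposition property. -/
theorem dualGrothendieck_snp_idp (m : ℕ) (lam : Fin m → ℕ) (hlam : Antitone lam) :
    (∀ μ : Fin m → ℕ, Antitone μ →
      (skewCount m lam μ ≠ 0 ↔
        ((fun k : Fin m => if (k : ℕ) = 0 then lam k else 0) ≤ μ ∧ μ ≤ lam))) ∧
    HasSNP (dualGrothendieck m lam) ∧ HasIDP (NewtonP (dualGrothendieck m lam)) := by
  refine ⟨fun μ _ => skewCount_ne_zero_iff m lam μ, ?_, ?_⟩
  · apply Set.Subset.antisymm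
    · rintro x ⟨hx, hl⟩
      obtain ⟨h1, h2, h3⟩ := newton_subset m lam hlam x hx
      obtain ⟨α, rfl⟩ := nat_of_lattice x hl h1
      refine ⟨α, ?_, rfl⟩
      rw [dualGrothendieck_ne_zero_iff m lam hlam]
      refine ⟨fun S => ?_, ?_⟩
      · have := h2 S
        dsimp only at this
        exact_mod_cast this
      · dsimp only at h3
        exact_mod_cast h3
    · intro x hx
      refine ⟨subset_convexHull ℝ _ hx, ?_⟩
      obtain ⟨α, _, rfl⟩ := hx
      exact lattice_of_nat α
  · rintro t ht p hp hl
    rw [Set.mem_smul_set] at hp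
    obtain ⟨x, hx, rfl⟩ := hp
    obtain ⟨h1, h2, h3⟩ := newton_subset m lam hlam x hx
    have ht0 : (0 : ℝ) ≤ t := Nat.cast_nonneg t
    obtain ⟨p, hp⟩ := nat_of_lattice _ hl (fun i => mul_nonneg ht0 (h1 i))
    have hpx : ∀ i, (p i : ℝ) = t * x i := fun i => (congrFun hp i).symm
    obtain ⟨v, hv1, hv2⟩ := decomp t ht (ext0 lam) (ext0_antitone lam hlam) p
      (by
        intro S
        have := mul_le_mul_of_nonneg_left (h2 S) ht0
        rw [Finset.mul_sum, ← Finset.sum_congr rfl fun i _ => hpx i] at this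
        exact_mod_cast this)
      (by
        have := mul_le_mul_of_nonneg_left h3 ht0
        rw [Finset.mul_sum, ← Finset.sum_congr rfl fun i _ => hpx i] at this
        exact_mod_cast this)
    refine ⟨fun j i => (v j i : ℝ), fun j => ⟨?_, lattice_of_nat _⟩, ?_⟩
    · apply subset_convexHull ℝ _
      exact ⟨v j, (dualGrothendieck_ne_zero_iff m lam hlam _).mpr (hv1 j), rfl⟩
    · rw [hp]
      funext i
      rw [Finset.sum_apply, hv2 i]
      push_cast
      rfl
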